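/- Let J₀(x) = (1/π)∫₀^π cos(x sin θ) dθ. Let f : (0, ∞) → ℝ be continuous, of bounded variation on every compact subinterval of (0, ∞), and satisfy ∫₀^∞ |f(r)|·√r dr < ∞. Define F₀(p) = ∫₀^∞ f(s)·J₀(p s)·s ds for p > 0. Then for every r > 0, the Hankel inversion formula holds: f(r) = lim_{R → ∞} ∫₀^R F₀(p)·J₀(p r)·p dp. -/

import Mathlib

open Real MeasureTheory Filter Topology

noncomputable def J0 (x : ℝ) : ℝ := (1 / π) * ∫ θ in (0:ℝ)..π, Real.cos (x * Real.sin θ)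

/-- The Bessel function of the first kind of order one. -/
noncomputable def J1 (x : ℝ) : ℝ :=
  (1 / π) * ∫ θ in (0:ℝ)..π, Real.sin θ * Real.sin (x * Real.sin θ)

/-- The derivative of `J1`, as an integral. -/
noncomputable def J1Deriv (x : ℝ) : ℝ :=
  (1 / π) * ∫ θ in (0:ℝ)..π, Real.sin θ ^ 2 * Real.cos (x * Real.sin θ)

lemma abs_inv_pi_mul_integral_le {h : ℝ → ℝ} (hh : ∀ θ, |h θ| ≤ 1) :
    |(1 / π) * ∫ θ in (0:ℝ)..π, h θ| ≤ 1 := by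
  have := intervalIntegral.norm_integral_le_of_norm_le_const (a := 0) (b := π) (f := h) (C := 1)
    (fun x _ => hh x)
  rw [Real.norm_eq_abs, sub_zero, one_mul, abs_of_pos pi_pos] at this
  rw [abs_mul, abs_of_pos (by positivity), one_div, inv_mul_le_iff₀ pi_pos, mul_one]
  exact this

lemma abs_J0_le_one (x : ℝ) : |J0 x| ≤ 1 :=
  abs_inv_pi_mul_integral_le fun _ => abs_cos_le_one _

lemma abs_J1_le_one (x : ℝ) : |J1 x| ≤ 1 :=
  abs_inv_pi_mul_integral_le fun θ => by
    rw [abs_mul]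
    exact mul_le_one₀ (abs_sin_le_one _) (abs_nonneg _) (abs_sin_le_one _)

@[simp] lemma J0_zero : J0 0 = 1 := by
  simp [J0, pi_ne_zero]

lemma hasDerivAt_J0 (x : ℝ) : HasDerivAt J0 (-J1 x) x := by
  have h := intervalIntegral.hasDerivAt_integral_of_dominated_loc_of_deriv_le
    (μ := volume) (a := 0) (b := π) (x₀ := x) (s := Set.univ) (bound := fun _ => 1)
    (F := fun x θ => Real.cos (x * Real.sin θ))
    (F' := fun x θ => -(Real.sin θ * Real.sin (x * Real.sin θ))) Filter.univ_mem
    (Eventually.of_forall fun y => (by fun_prop : Continuous _).aestronglyMeasurable)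
    ((by fun_prop : Continuous _).intervalIntegrable _ _)
    (by fun_prop : Continuous _).aestronglyMeasurable
    (ae_of_all _ fun θ _ y _ => by
      rw [norm_neg, Real.norm_eq_abs, abs_mul]
      exact mul_le_one₀ (abs_sin_le_one _) (abs_nonneg _) (abs_sin_le_one _))
    intervalIntegrable_const
    (ae_of_all _ fun θ _ y _ => by
      have := ((hasDerivAt_id y).mul_const (Real.sin θ)).cos
      convert! this using 1
      simp; ring)
  have h2 := h.2.const_mul (1 / π)
  rw [intervalIntegral.integral_neg] at h2
  convert! h2 using 1
  simp [J1]

lemma hasDerivAt_J1 (x : ℝ) : HasDerivAt J1 (J1Deriv x) x := by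
  have h := intervalIntegral.hasDerivAt_integral_of_dominated_loc_of_deriv_le
    (μ := volume) (a := 0) (b := π) (x₀ := x) (s := Set.univ) (bound := fun _ => 1)
    (F := fun x θ => Real.sin θ * Real.sin (x * Real.sin θ))
    (F' := fun x θ => Real.sin θ ^ 2 * Real.cos (x * Real.sin θ)) Filter.univ_mem
    (Eventually.of_forall fun y => (by fun_prop : Continuous _).aestronglyMeasurable)
    ((by fun_prop : Continuous _).intervalIntegrable _ _)
    (by fun_prop : Continuous _).aestronglyMeasurable
    (ae_of_all _ fun θ _ y _ => by
      rw [Real.norm_eq_abs, abs_mul, abs_pow]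
      exact mul_le_one₀ (pow_le_one₀ (abs_nonneg _) (abs_sin_le_one _)) (abs_nonneg _)
        (abs_cos_le_one _))
    intervalIntegrable_const
    (ae_of_all _ fun θ _ y _ => by
      have := (((hasDerivAt_id y).mul_const (Real.sin θ)).sin).const_mul (Real.sin θ)
      convert! this using 1
      simp; ring)
  exact h.2.const_mul (1 / π)

lemma continuous_J0 : Continuous J0 :=
  continuous_iff_continuousAt.2 fun x => (hasDerivAt_J0 x).continuousAt

lemma continuous_J1 : Continuous J1 :=
  continuous_iff_continuousAt.2 fun x => (hasDerivAt_J1 x).continuousAt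

/-- Bessel's equation, as a first order relation between `J1`, its derivative and `J0`. -/
lemma mul_J1Deriv_add_J1 (x : ℝ) : x * J1Deriv x + J1 x = x * J0 x := by
  have key : ∫ θ in (0:ℝ)..π, (-(Real.sin θ * Real.sin (x * Real.sin θ)) +
      x * (Real.cos θ ^ 2 * Real.cos (x * Real.sin θ))) = 0 := by
    rw [intervalIntegral.integral_eq_sub_of_hasDerivAt
      (f := fun θ => Real.cos θ * Real.sin (x * Real.sin θ))]
    · simp
    · intro θ _
      have := (Real.hasDerivAt_cos θ).mul (((Real.hasDerivAt_sin θ).const_mul x).sin)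
      convert! this using 1
      ring
    · exact (by fun_prop : Continuous _).intervalIntegrable _ _
  have hsplit : ∀ θ : ℝ, -(Real.sin θ * Real.sin (x * Real.sin θ)) +
      x * (Real.cos θ ^ 2 * Real.cos (x * Real.sin θ)) =
      -(Real.sin θ * Real.sin (x * Real.sin θ)) +
      (x * Real.cos (x * Real.sin θ) - x * (Real.sin θ ^ 2 * Real.cos (x * Real.sin θ))) := by
    intro θ
    rw [Real.cos_sq']; ring
  simp_rw [hsplit] at key
  rw [intervalIntegral.integral_add, intervalIntegral.integral_sub, intervalIntegral.integral_neg,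
    intervalIntegral.integral_const_mul, intervalIntegral.integral_const_mul] at key
  · unfold J1Deriv J1 J0
    linear_combination (-(1 / π)) * key
  all_goals exact (by fun_prop : Continuous _).intervalIntegrable _ _

lemma hasDerivAt_mul_J1 (x : ℝ) : HasDerivAt (fun x => x * J1 x) (x * J0 x) x := by
  have := (hasDerivAt_id x).mul (hasDerivAt_J1 x)
  convert! this using 1
  rw [← mul_J1Deriv_add_J1]; simp; ring

/-- Lommel's integral. -/
lemma integral_J0_mul_J0 (r s R : ℝ) :
    (s ^ 2 - r ^ 2) * ∫ p in (0:ℝ)..R, J0 (p * s) * J0 (p * r) * p =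
      R * (s * J1 (R * s) * J0 (R * r) - r * J0 (R * s) * J1 (R * r)) := by
  rw [← intervalIntegral.integral_const_mul, intervalIntegral.integral_eq_sub_of_hasDerivAt
    (f := fun p => (p * s * J1 (p * s)) * J0 (p * r) - (p * r * J1 (p * r)) * J0 (p * s))]
  · ring
  · intro p _
    have h1 : ∀ s : ℝ, HasDerivAt (fun p => p * s * J1 (p * s)) (p * s * J0 (p * s) * s) p := by
      intro s
      have := (hasDerivAt_mul_J1 (p * s)).comp p ((hasDerivAt_id p).mul_const s)
      convert! this using 1
      simp
    have h0 : ∀ s : ℝ, HasDerivAt (fun p => J0 (p * s)) (-J1 (p * s) * s) p := by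
      intro s
      have := (hasDerivAt_J0 (p * s)).comp p ((hasDerivAt_id p).mul_const s)
      convert! this using 1
      simp
    convert! ((h1 s).mul (h0 r)).sub ((h1 r).mul (h0 s)) using 1
    ring
  · have := continuous_J0
    exact (by fun_prop : Continuous _).intervalIntegrable _ _

lemma integrableOn_rpow_mul_exp_neg_sq_div_two {k : ℝ} (hk : -1 < k) :
    IntegrableOn (fun s : ℝ => s ^ k * Real.exp (-s ^ 2 / 2)) (Set.Ioi 0) := by
  refine (integrableOn_rpow_mul_exp_neg_mul_sq (b := 1 / 2) (by norm_num) hk).congr_fun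
    (fun s _ => ?_) measurableSet_Ioi
  dsimp only
  congr 2; ring

lemma integrableOn_mul_exp_neg_sq_div_two :
    IntegrableOn (fun s : ℝ => s * Real.exp (-s ^ 2 / 2)) (Set.Ioi 0) := by
  simpa using integrableOn_rpow_mul_exp_neg_sq_div_two (k := 1) (by norm_num)

lemma integrableOn_sq_mul_exp_neg_sq_div_two :
    IntegrableOn (fun s : ℝ => s ^ 2 * Real.exp (-s ^ 2 / 2)) (Set.Ioi 0) := by
  simpa using integrableOn_rpow_mul_exp_neg_sq_div_two (k := 2) (by norm_num)

lemma hasDerivAt_exp_neg_sq_div_two (s : ℝ) :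
    HasDerivAt (fun s : ℝ => Real.exp (-s ^ 2 / 2)) (-s * Real.exp (-s ^ 2 / 2)) s := by
  convert! (((hasDerivAt_id s).pow 2).neg.div_const 2).exp using 1
  simp; ring

lemma tendsto_mul_exp_neg_sq_div_two_atTop :
    Tendsto (fun s : ℝ => s * Real.exp (-s ^ 2 / 2)) atTop (𝓝 0) := by
  have h := Real.tendsto_pow_mul_exp_neg_atTop_nhds_zero 1
  refine squeeze_zero' ?_ ?_ h
  · filter_upwards [eventually_ge_atTop 0] with s hs
    positivity
  · filter_upwards [eventually_ge_atTop 2] with s hs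
    rw [pow_one]
    have : -s ^ 2 / 2 ≤ -s := by nlinarith
    gcongr

lemma integral_mul_exp_neg_sq_div_two :
    ∫ s in Set.Ioi (0:ℝ), s * Real.exp (-s ^ 2 / 2) = 1 := by
  have hlim : Tendsto (fun s : ℝ => -Real.exp (-s ^ 2 / 2)) atTop (𝓝 0) := by
    rw [← neg_zero]
    refine (Real.tendsto_exp_atBot.comp ?_).neg
    have : Tendsto (fun s : ℝ => s ^ 2 / 2) atTop atTop :=
      (tendsto_pow_atTop two_ne_zero).atTop_div_const two_pos
    simpa only [neg_div, Function.comp_def] using tendsto_neg_atTop_atBot.comp this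
  rw [integral_Ioi_of_hasDerivAt_of_tendsto' (f := fun s => -Real.exp (-s ^ 2 / 2)) (m := 0)
    _ integrableOn_mul_exp_neg_sq_div_two hlim]
  · simp
  · intro s _
    convert! (hasDerivAt_exp_neg_sq_div_two s).neg using 1
    ring

lemma integral_exp_mul_J1 (p : ℝ) :
    ∫ s in Set.Ioi (0:ℝ), s ^ 2 * Real.exp (-s ^ 2 / 2) * J1 (p * s) =
      p * ∫ s in Set.Ioi (0:ℝ), Real.exp (-s ^ 2 / 2) * J0 (p * s) * s := by
  have c0 := continuous_J0
  have c1 := continuous_J1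
  have i1 : IntegrableOn (fun s => s ^ 2 * Real.exp (-s ^ 2 / 2) * J1 (p * s)) (Set.Ioi 0) :=
    integrableOn_sq_mul_exp_neg_sq_div_two.mul_bdd (c := 1)
      (by fun_prop : Continuous _).aestronglyMeasurable (ae_of_all _ fun s => abs_J1_le_one _)
  have i0 : IntegrableOn (fun s => Real.exp (-s ^ 2 / 2) * J0 (p * s) * s) (Set.Ioi 0) := by
    have : IntegrableOn (fun s => s * Real.exp (-s ^ 2 / 2) * J0 (p * s)) (Set.Ioi 0) :=
      integrableOn_mul_exp_neg_sq_div_two.mul_bdd (c := 1)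
        (by fun_prop : Continuous _).aestronglyMeasurable (ae_of_all _ fun s => abs_J0_le_one _)
    refine this.congr_fun (fun s _ => ?_) measurableSet_Ioi
    ring
  have hlim : Tendsto (fun s => -(s * Real.exp (-s ^ 2 / 2) * J1 (p * s))) atTop (𝓝 0) := by
    rw [← neg_zero]
    refine Tendsto.neg ?_
    refine squeeze_zero_norm' ?_ tendsto_mul_exp_neg_sq_div_two_atTop
    filter_upwards [eventually_ge_atTop 0] with s hs
    rw [norm_mul, Real.norm_of_nonneg (by positivity : 0 ≤ s * Real.exp (-s ^ 2 / 2))]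
    exact mul_le_of_le_one_right (by positivity) (abs_J1_le_one _)
  have key := integral_Ioi_of_hasDerivAt_of_tendsto' (a := 0)
    (f := fun s => -(s * Real.exp (-s ^ 2 / 2) * J1 (p * s))) (m := 0)
    (f' := fun s => s ^ 2 * Real.exp (-s ^ 2 / 2) * J1 (p * s)
      - p * (Real.exp (-s ^ 2 / 2) * J0 (p * s) * s)) ?_ (i1.sub (i0.const_mul p)) hlim
  · rw [integral_sub i1 (i0.const_mul p), integral_const_mul] at key
    simp only [zero_mul, neg_zero, sub_zero] at key
    linarith
  · intro s _
    have h1 : HasDerivAt (fun s => J1 (p * s)) (J1Deriv (p * s) * p) s := by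
      have := (hasDerivAt_J1 (p * s)).comp s ((hasDerivAt_id s).const_mul p)
      convert! this using 1
      simp
    convert! (((hasDerivAt_id s).mul (hasDerivAt_exp_neg_sq_div_two s)).mul h1).neg using 1
    have := mul_J1Deriv_add_J1 (p * s)
    simp only [Pi.mul_apply, id]
    linear_combination Real.exp (-s ^ 2 / 2) * this

lemma hasDerivAt_integral_exp_mul_J0 (p : ℝ) :
    HasDerivAt (fun p => ∫ s in Set.Ioi (0:ℝ), Real.exp (-s ^ 2 / 2) * J0 (p * s) * s)
      (-p * ∫ s in Set.Ioi (0:ℝ), Real.exp (-s ^ 2 / 2) * J0 (p * s) * s) p := by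
  have c0 := continuous_J0
  have c1 := continuous_J1
  have h := hasDerivAt_integral_of_dominated_loc_of_deriv_le
    (μ := volume.restrict (Set.Ioi (0:ℝ))) (x₀ := p) (s := Set.univ)
    (bound := fun s => s ^ 2 * Real.exp (-s ^ 2 / 2))
    (F := fun p s => Real.exp (-s ^ 2 / 2) * J0 (p * s) * s)
    (F' := fun p s => -(s ^ 2 * Real.exp (-s ^ 2 / 2) * J1 (p * s))) Filter.univ_mem
    (Eventually.of_forall fun y => (by fun_prop : Continuous _).aestronglyMeasurable)
    ?_ (by fun_prop : Continuous _).aestronglyMeasurable ?_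
    integrableOn_sq_mul_exp_neg_sq_div_two ?_
  · convert! h.2 using 1
    rw [integral_neg, integral_exp_mul_J1]; ring
  · have : IntegrableOn (fun s => s * Real.exp (-s ^ 2 / 2) * J0 (p * s)) (Set.Ioi 0) :=
      integrableOn_mul_exp_neg_sq_div_two.mul_bdd (c := 1)
        (by fun_prop : Continuous _).aestronglyMeasurable (ae_of_all _ fun s => abs_J0_le_one _)
    refine this.congr_fun (fun s _ => ?_) measurableSet_Ioi
    ring
  · refine ae_of_all _ fun s y _ => ?_
    rw [norm_neg, norm_mul, Real.norm_of_nonneg (by positivity : 0 ≤ s ^ 2 * Real.exp (-s ^ 2 / 2))]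
    exact mul_le_of_le_one_right (by positivity) (abs_J1_le_one _)
  · refine ae_of_all _ fun s y _ => ?_
    have h1 : HasDerivAt (fun p => J0 (p * s)) (-J1 (y * s) * s) y := by
      have := (hasDerivAt_J0 (y * s)).comp y ((hasDerivAt_id y).mul_const s)
      convert! this using 1
      simp
    convert! ((h1.const_mul (Real.exp (-s ^ 2 / 2))).mul_const s) using 1
    ring

/-- The Gaussian `exp (-s ^ 2 / 2)` is its own Hankel transform. -/
lemma integral_exp_mul_J0 (p : ℝ) :
    ∫ s in Set.Ioi (0:ℝ), Real.exp (-s ^ 2 / 2) * J0 (p * s) * s = Real.exp (-p ^ 2 / 2) := by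
  set F : ℝ → ℝ := fun p => ∫ s in Set.Ioi (0:ℝ), Real.exp (-s ^ 2 / 2) * J0 (p * s) * s with hF
  have hd : ∀ x, HasDerivAt (fun x => F x * Real.exp (x ^ 2 / 2)) 0 x := by
    intro x
    have h2 : HasDerivAt (fun x : ℝ => Real.exp (x ^ 2 / 2)) (Real.exp (x ^ 2 / 2) * x) x := by
      convert! (((hasDerivAt_id x).pow 2).div_const 2).exp using 1
      simp
    convert! (hasDerivAt_integral_exp_mul_J0 x).mul h2 using 1
    ring
  have hconst := is_const_of_deriv_eq_zero (fun x => (hd x).differentiableAt)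
    (fun x => (hd x).deriv) p 0
  have h0 : F 0 = 1 := by
    rw [← integral_mul_exp_neg_sq_div_two, hF]
    simp [mul_comm]
  simp only [h0] at hconst
  change F p = _
  rw [neg_div, Real.exp_neg, ← one_div, eq_div_iff (Real.exp_pos _).ne', hconst]
  simp

lemma tendsto_hankel_inversion_exp (r : ℝ) :
    Tendsto (fun R => ∫ p in (0:ℝ)..R,
      (∫ s in Set.Ioi (0:ℝ), Real.exp (-s ^ 2 / 2) * J0 (p * s) * s) * J0 (p * r) * p)
      atTop (𝓝 (Real.exp (-r ^ 2 / 2))) := by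
  have c0 := continuous_J0
  simp_rw [integral_exp_mul_J0]
  rw [← integral_exp_mul_J0 r]
  simp_rw [mul_comm r]
  refine intervalIntegral_tendsto_integral_Ioi 0 ?_ tendsto_id
  have : IntegrableOn (fun s => s * Real.exp (-s ^ 2 / 2) * J0 (s * r)) (Set.Ioi 0) :=
    integrableOn_mul_exp_neg_sq_div_two.mul_bdd (c := 1)
      (by fun_prop : Continuous _).aestronglyMeasurable (ae_of_all _ fun s => abs_J0_le_one _)
  refine this.congr_fun (fun s _ => ?_) measurableSet_Ioi
  ring

/-- The solution `√x J₀(x)` of the normal form `u'' + (1 + 1 / (4 x ^ 2)) u = 0` of Bessel's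
equation. -/
noncomputable def besselU (x : ℝ) : ℝ := √x * J0 x

/-- The function `√x J₁(x)`. -/
noncomputable def besselV (x : ℝ) : ℝ := √x * J1 x

/-- The negative of the derivative of `besselU`. -/
noncomputable def besselW (x : ℝ) : ℝ := √x * J1 x - J0 x / (2 * √x)

/-- The slowly varying coefficient of `cos` in `besselU`. -/
noncomputable def besselA (x : ℝ) : ℝ := besselU x * Real.cos x + besselW x * Real.sin x

/-- The slowly varying coefficient of `sin` in `besselU`. -/
noncomputable def besselB (x : ℝ) : ℝ := besselU x * Real.sin x - besselW x * Real.cos x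

lemma continuous_besselU : Continuous besselU := Real.continuous_sqrt.mul continuous_J0

lemma continuous_besselV : Continuous besselV := Real.continuous_sqrt.mul continuous_J1

lemma besselV_eq {x : ℝ} (hx : 0 < x) : besselV x = besselW x + besselU x / (2 * x) := by
  have h := Real.sq_sqrt hx.le
  have h0 : √x ≠ 0 := (Real.sqrt_pos.2 hx).ne'
  unfold besselV besselW besselU
  field_simp
  rw [h]
  ring

lemma besselU_eq (x : ℝ) :
    besselU x = besselA x * Real.cos x + besselB x * Real.sin x := by
  unfold besselA besselB
  linear_combination -besselU x * Real.sin_sq_add_cos_sq x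

lemma besselW_eq (x : ℝ) :
    besselW x = besselA x * Real.sin x - besselB x * Real.cos x := by
  unfold besselA besselB
  linear_combination -besselW x * Real.sin_sq_add_cos_sq x

lemma hasDerivAt_besselU {x : ℝ} (hx : 0 < x) : HasDerivAt besselU (-besselW x) x := by
  convert! (Real.hasDerivAt_sqrt hx.ne').mul (hasDerivAt_J0 x) using 1
  unfold besselW
  ring

lemma hasDerivAt_besselW {x : ℝ} (hx : 0 < x) :
    HasDerivAt besselW ((1 + 1 / (4 * x ^ 2)) * besselU x) x := by
  have h0 : √x ≠ 0 := (Real.sqrt_pos.2 hx).ne'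
  have hs := Real.hasDerivAt_sqrt hx.ne'
  convert! (hs.mul (hasDerivAt_J1 x)).sub ((hasDerivAt_J0 x).div (hs.const_mul 2)
    (by positivity)) using 1
  have h := Real.sq_sqrt hx.le
  have hJ : J1Deriv x = J0 x - J1 x / x := by
    rw [eq_sub_iff_add_eq, ← mul_right_inj' hx.ne', mul_add, ← mul_J1Deriv_add_J1]
    field_simp
  rw [hJ]
  unfold besselU
  generalize √x = y at *
  subst h
  field_simp
  ring

lemma hasDerivAt_besselA {x : ℝ} (hx : 0 < x) :
    HasDerivAt besselA (besselU x * Real.sin x / (4 * x ^ 2)) x := by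
  convert! ((hasDerivAt_besselU hx).mul (Real.hasDerivAt_cos x)).add
    ((hasDerivAt_besselW hx).mul (Real.hasDerivAt_sin x)) using 1
  field_simp
  ring

lemma hasDerivAt_besselB {x : ℝ} (hx : 0 < x) :
    HasDerivAt besselB (-(besselU x * Real.cos x / (4 * x ^ 2))) x := by
  convert! ((hasDerivAt_besselU hx).mul (Real.hasDerivAt_sin x)).sub
    ((hasDerivAt_besselW hx).mul (Real.hasDerivAt_cos x)) using 1
  field_simp
  ring

lemma besselW_sq_add_le {x : ℝ} (hx : 1 ≤ x) :
    besselW x ^ 2 + (1 + 1 / (4 * x ^ 2)) * besselU x ^ 2 ≤ 4 := by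
  have hd : ∀ y : ℝ, 0 < y → HasDerivAt
      (fun y => besselW y ^ 2 + (1 + 1 / (4 * y ^ 2)) * besselU y ^ 2)
      (-(besselU y ^ 2 / (2 * y ^ 3))) y := by
    intro y hy
    have h4 : HasDerivAt (fun y : ℝ => 1 + 1 / (4 * y ^ 2)) (-(1 / (2 * y ^ 3))) y := by
      have := ((hasDerivAt_const y (1:ℝ)).div (((hasDerivAt_id y).pow 2).const_mul 4)
        (by simp [hy.ne'])).const_add 1
      convert! this using 1
      simp
      field_simp
      ring
    convert! ((hasDerivAt_besselW hy).pow 2).add (h4.mul ((hasDerivAt_besselU hy).pow 2)) using 1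
    simp
    field_simp
    ring
  have hanti : AntitoneOn (fun y => besselW y ^ 2 + (1 + 1 / (4 * y ^ 2)) * besselU y ^ 2)
      (Set.Ici 1) := by
    refine antitoneOn_of_deriv_nonpos (convex_Ici 1) ?_ ?_ ?_
    · intro y hy
      exact (hd y (zero_lt_one.trans_le hy)).continuousAt.continuousWithinAt
    · intro y hy
      rw [interior_Ici] at hy
      exact (hd y (zero_lt_one.trans hy)).differentiableAt.differentiableWithinAt
    · intro y hy
      rw [interior_Ici] at hy
      have hy0 : 0 < y := zero_lt_one.trans hy
      rw [(hd y hy0).deriv]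
      have : 0 ≤ besselU y ^ 2 / (2 * y ^ 3) := by positivity
      linarith
  refine (hanti (Set.mem_Ici.2 le_rfl) hx hx).trans ?_
  simp only [besselW, besselU, Real.sqrt_one]
  have h0 := abs_le.1 (abs_J0_le_one 1)
  have h1 := abs_le.1 (abs_J1_le_one 1)
  nlinarith [mul_nonneg (sub_nonneg.2 h0.2) (sub_nonneg.2 h1.2),
    mul_nonneg (sub_nonneg.2 h0.1) (sub_nonneg.2 h1.1),
    mul_nonneg (sub_nonneg.2 h0.2) (sub_nonneg.2 h1.1),
    mul_nonneg (sub_nonneg.2 h0.1) (sub_nonneg.2 h1.2),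
    mul_nonneg (sub_nonneg.2 h0.2) (sub_nonneg.2 h0.1),
    mul_nonneg (sub_nonneg.2 h1.2) (sub_nonneg.2 h1.1)]

lemma abs_besselU_le (x : ℝ) : |besselU x| ≤ 2 := by
  rcases le_total x 1 with h | h
  · unfold besselU
    rw [abs_mul, abs_of_nonneg (Real.sqrt_nonneg x)]
    have := mul_le_mul (Real.sqrt_le_one.2 h) (abs_J0_le_one x) (abs_nonneg _) zero_le_one
    linarith
  · have := besselW_sq_add_le h
    refine abs_le_of_sq_le_sq (?_ : _ ≤ (2:ℝ) ^ 2) zero_le_two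
    have h2 : 0 ≤ 1 / (4 * x ^ 2) * besselU x ^ 2 := by positivity
    nlinarith [sq_nonneg (besselW x)]

lemma abs_besselW_le {x : ℝ} (hx : 1 ≤ x) : |besselW x| ≤ 2 := by
  have := besselW_sq_add_le hx
  refine abs_le_of_sq_le_sq (?_ : _ ≤ (2:ℝ) ^ 2) zero_le_two
  have h2 : 0 ≤ (1 + 1 / (4 * x ^ 2)) * besselU x ^ 2 := by positivity
  linarith

lemma abs_besselV_le (x : ℝ) : |besselV x| ≤ 3 := by
  rcases le_total x 1 with h | h
  · unfold besselV
    rw [abs_mul, abs_of_nonneg (Real.sqrt_nonneg x)]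
    have := mul_le_mul (Real.sqrt_le_one.2 h) (abs_J1_le_one x) (abs_nonneg _) zero_le_one
    linarith
  · rw [besselV_eq (by linarith)]
    have h1 : |besselU x / (2 * x)| ≤ 1 := by
      rw [abs_div, abs_of_nonneg (by linarith : 0 ≤ 2 * x), div_le_one (by linarith)]
      linarith [abs_besselU_le x]
    linarith [abs_add_le (besselW x) (besselU x / (2 * x)), abs_besselW_le h]

lemma abs_mul_le_of_abs_le_one {x y c : ℝ} (hx : |x| ≤ c) (hy : |y| ≤ 1) : |x * y| ≤ c := by
  rw [abs_mul]
  exact (mul_le_of_le_one_right (abs_nonneg _) hy).trans hx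

lemma abs_besselA_le {x : ℝ} (hx : 1 ≤ x) : |besselA x| ≤ 4 := by
  have h1 := abs_mul_le_of_abs_le_one (abs_besselU_le x) (abs_cos_le_one x)
  have h2 := abs_mul_le_of_abs_le_one (abs_besselW_le hx) (abs_sin_le_one x)
  unfold besselA
  linarith [abs_add_le (besselU x * Real.cos x) (besselW x * Real.sin x)]

lemma abs_besselB_le {x : ℝ} (hx : 1 ≤ x) : |besselB x| ≤ 4 := by
  have h1 := abs_mul_le_of_abs_le_one (abs_besselU_le x) (abs_sin_le_one x)
  have h2 := abs_mul_le_of_abs_le_one (abs_besselW_le hx) (abs_cos_le_one x)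
  unfold besselB
  linarith [abs_sub (besselU x * Real.sin x) (besselW x * Real.cos x)]

lemma abs_besselU_mul_div_le {m x t : ℝ} (hm : 0 < m) (hx : m ≤ x) (ht : |t| ≤ 1) :
    |besselU x * t / (4 * x ^ 2)| ≤ 1 / m ^ 2 := by
  have hx0 : 0 < x := hm.trans_le hx
  rw [abs_div, abs_of_pos (by positivity : 0 < 4 * x ^ 2)]
  rw [div_le_div_iff₀ (by positivity) (by positivity)]
  have h := abs_mul_le_of_abs_le_one (abs_besselU_le x) ht
  have h2 : m ^ 2 ≤ x ^ 2 := by gcongr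
  nlinarith [sq_nonneg m, abs_nonneg (besselU x * t)]

lemma abs_besselA_sub_le {m x y : ℝ} (hm : 0 < m) (hx : m ≤ x) (hy : m ≤ y) :
    |besselA y - besselA x| ≤ 1 / m ^ 2 * |y - x| :=
  (convex_Ici m).norm_image_sub_le_of_norm_hasDerivWithin_le
    (fun _ hz => (hasDerivAt_besselA (hm.trans_le hz)).hasDerivWithinAt)
    (fun z hz => abs_besselU_mul_div_le hm hz (abs_sin_le_one z)) hx hy

lemma abs_besselB_sub_le {m x y : ℝ} (hm : 0 < m) (hx : m ≤ x) (hy : m ≤ y) :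
    |besselB y - besselB x| ≤ 1 / m ^ 2 * |y - x| :=
  (convex_Ici m).norm_image_sub_le_of_norm_hasDerivWithin_le
    (fun z hz => (hasDerivAt_besselB (hm.trans_le hz)).hasDerivWithinAt)
    (fun z hz => by
      rw [norm_neg]
      exact abs_besselU_mul_div_le hm hz (abs_cos_le_one z)) hx hy

lemma integrableOn_besselU_mul_div {t : ℝ → ℝ} (hc : Continuous t) (ht : ∀ x, |t x| ≤ 1) :
    IntegrableOn (fun x => besselU x * t x / (4 * x ^ 2)) (Set.Ioi 1) := by
  have := continuous_besselU
  refine Integrable.mono' (g := fun x : ℝ => x ^ (-2 : ℝ))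
    (integrableOn_Ioi_rpow_of_lt (by norm_num) one_pos)
    (((this.mul hc).measurable.div (by fun_prop)).aestronglyMeasurable) ?_
  refine (ae_restrict_iff' measurableSet_Ioi).2 (ae_of_all _ fun x hx => ?_)
  have hx0 : (0:ℝ) < x := one_pos.trans hx
  refine (abs_besselU_mul_div_le hx0 le_rfl (ht x)).trans_eq ?_
  rw [Real.rpow_neg hx0.le, one_div, Real.rpow_two]

lemma exists_tendsto_besselA : ∃ A, Tendsto besselA atTop (𝓝 A) :=
  ⟨_, tendsto_limUnder_of_hasDerivAt_of_integrableOn_Ioi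
    (fun _ hx => hasDerivAt_besselA (one_pos.trans hx))
    (integrableOn_besselU_mul_div Real.continuous_sin abs_sin_le_one)⟩

lemma exists_tendsto_besselB : ∃ B, Tendsto besselB atTop (𝓝 B) :=
  ⟨_, tendsto_limUnder_of_hasDerivAt_of_integrableOn_Ioi
    (fun _ hx => hasDerivAt_besselB (one_pos.trans hx))
    (integrableOn_besselU_mul_div Real.continuous_cos abs_cos_le_one).neg⟩

lemma tendsto_mul_cos_add_mul_sin_sub {a b : ℝ → ℝ} {A B : ℝ} (ha : Tendsto a atTop (𝓝 A))
    (hb : Tendsto b atTop (𝓝 B)) :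
    Tendsto (fun x => a x * Real.cos x + b x * Real.sin x - (A * Real.cos x + B * Real.sin x))
      atTop (𝓝 0) := by
  have h1 : Tendsto (fun x => |a x - A| + |b x - B|) atTop (𝓝 0) := by
    have := (tendsto_sub_nhds_zero_iff.2 ha).abs.add (tendsto_sub_nhds_zero_iff.2 hb).abs
    simpa using this
  refine squeeze_zero_norm (fun x => ?_) h1
  have e : a x * Real.cos x + b x * Real.sin x - (A * Real.cos x + B * Real.sin x) =
    (a x - A) * Real.cos x + (b x - B) * Real.sin x := by ring
  rw [e, Real.norm_eq_abs]
  exact (abs_add_le _ _).trans (add_le_add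
    (abs_mul_le_of_abs_le_one le_rfl (abs_cos_le_one x))
    (abs_mul_le_of_abs_le_one le_rfl (abs_sin_le_one x)))

lemma exists_asymptotic_besselU : ∃ A B, Tendsto
    (fun x => besselU x - (A * Real.cos x + B * Real.sin x)) atTop (𝓝 0) := by
  obtain ⟨A, hA⟩ := exists_tendsto_besselA
  obtain ⟨B, hB⟩ := exists_tendsto_besselB
  refine ⟨A, B, (tendsto_mul_cos_add_mul_sin_sub hA hB).congr fun x => ?_⟩
  rw [← besselU_eq]

lemma exists_asymptotic_besselV : ∃ A B, Tendsto
    (fun x => besselV x - (A * Real.cos x + B * Real.sin x)) atTop (𝓝 0) := by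
  obtain ⟨A, hA⟩ := exists_tendsto_besselA
  obtain ⟨B, hB⟩ := exists_tendsto_besselB
  have h0 : Tendsto (fun x => besselU x / (2 * x)) atTop (𝓝 0) := by
    refine squeeze_zero_norm' (a := fun x => x⁻¹) ?_ tendsto_inv_atTop_zero
    filter_upwards [eventually_gt_atTop 0] with x hx
    rw [Real.norm_eq_abs, abs_div, abs_of_pos (by linarith : 0 < 2 * x), div_le_iff₀ (by linarith)]
    have := abs_besselU_le x
    field_simp
    linarith
  refine ⟨-B, A, ?_⟩
  have := (tendsto_mul_cos_add_mul_sin_sub hB.neg hA).add h0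
  rw [add_zero] at this
  refine this.congr' ?_
  filter_upwards [eventually_gt_atTop 0] with x hx
  rw [besselV_eq hx, besselW_eq]
  ring

lemma tendsto_integral_mul_cos_sin {ψ : ℝ → ℝ} (hψ : Integrable ψ) :
    Tendsto (fun R => ∫ s, ψ s * Real.cos (R * s)) atTop (𝓝 0) ∧
      Tendsto (fun R => ∫ s, ψ s * Real.sin (R * s)) atTop (𝓝 0) := by
  have h := Real.tendsto_integral_exp_smul_cocompact (fun s => (ψ s : ℂ))
  have h2 : Tendsto (fun R : ℝ => R / (2 * π)) atTop (cocompact ℝ) :=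
    (tendsto_id.atTop_div_const (by positivity)).mono_right atTop_le_cocompact
  have h3 := h.comp h2
  have hint : ∀ R : ℝ, Integrable fun s => Real.fourierChar (-(s * (R / (2 * π)))) • (ψ s : ℂ) := by
    intro R
    have := (Real.fourierIntegral_convergent_iff (R / (2 * π)) (μ := volume)
      (f := fun s => (ψ s : ℂ))).2 hψ.ofReal
    simpa [mul_comm] using this
  have e : ∀ R s : ℝ, Real.fourierChar (-(s * (R / (2 * π)))) • (ψ s : ℂ) =
      ⟨ψ s * Real.cos (R * s), -(ψ s * Real.sin (R * s))⟩ := by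
    intro R s
    rw [Circle.smul_def, Real.fourierChar_apply]
    have : ((2 * π * -(s * (R / (2 * π))) : ℝ) : ℂ) = ((-(R * s) : ℝ) : ℂ) := by
      congr 1; field_simp
    rw [this, Complex.exp_mul_I, ← Complex.ofReal_cos, ← Complex.ofReal_sin, Real.cos_neg,
      Real.sin_neg]
    generalize Real.cos (R * s) = c, Real.sin (R * s) = d
    apply Complex.ext <;> simp [mul_comm]
  constructor
  · refine ((Complex.continuous_re.tendsto 0).comp h3).congr fun R => ?_
    have := (Complex.reCLM.integral_comp_comm (hint R))
    simp only [Function.comp_def, Complex.reCLM_apply] at this ⊢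
    rw [← this]
    simp_rw [e]
  · rw [← neg_zero]
    refine ((Complex.continuous_im.tendsto 0).comp h3).neg.congr fun R => ?_
    have := (Complex.imCLM.integral_comp_comm (hint R))
    simp only [Function.comp_def, Complex.imCLM_apply] at this ⊢
    rw [← this]
    simp_rw [e]
    rw [integral_neg, neg_neg]

/-- A Riemann-Lebesgue lemma for bounded functions asymptotic to a trigonometric function. -/
lemma tendsto_setIntegral_mul_comp_mul {ψ v : ℝ → ℝ} {F : Set ℝ} {C A B : ℝ}
    (hF : MeasurableSet F) (hF0 : F ⊆ Set.Ioi 0) (hψ : IntegrableOn ψ F) (hv : Continuous v)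
    (hC : ∀ x, 0 ≤ x → |v x| ≤ C)
    (hlim : Tendsto (fun x => v x - (A * Real.cos x + B * Real.sin x)) atTop (𝓝 0)) :
    Tendsto (fun R => ∫ s in F, ψ s * v (R * s)) atTop (𝓝 0) := by
  obtain ⟨hcos, hsin⟩ := tendsto_integral_mul_cos_sin ((integrable_indicator_iff hF).2 hψ)
  have hind : ∀ w : ℝ → ℝ, ∫ s, F.indicator ψ s * w s = ∫ s in F, ψ s * w s := by
    intro w
    rw [← integral_indicator hF]
    simp_rw [← Set.indicator_mul_left]
  simp_rw [hind] at hcos hsin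
  set q : ℝ → ℝ := fun x => A * Real.cos x + B * Real.sin x with hq
  have hqc : Continuous q := by fun_prop
  have hqb : ∀ x, |q x| ≤ |A| + |B| := fun x =>
    (abs_add_le _ _).trans (add_le_add (abs_mul_le_of_abs_le_one le_rfl (abs_cos_le_one _))
      (abs_mul_le_of_abs_le_one le_rfl (abs_sin_le_one _)))
  have herr : Tendsto (fun R => ∫ s in F, ψ s * (v (R * s) - q (R * s))) atTop (𝓝 0) := by
    have := tendsto_integral_filter_of_dominated_convergence (μ := volume.restrict F)
      (l := atTop) (F := fun (R : ℝ) s => ψ s * (v (R * s) - q (R * s))) (f := fun _ => 0)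
      (fun s => |ψ s| * (C + (|A| + |B|))) ?_ ?_ (hψ.abs.mul_const _) ?_
    · simpa using this
    · exact Eventually.of_forall fun R =>
        hψ.aestronglyMeasurable.mul (by fun_prop : Continuous _).aestronglyMeasurable
    · filter_upwards [eventually_ge_atTop 0] with R hR
      refine (ae_restrict_iff' hF).2 (ae_of_all _ fun s hs => ?_)
      rw [Real.norm_eq_abs, abs_mul]
      refine mul_le_mul_of_nonneg_left ((abs_sub _ _).trans (add_le_add (hC _ ?_) (hqb _)))
        (abs_nonneg _)
      exact mul_nonneg hR (le_of_lt (hF0 hs))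
    · refine (ae_restrict_iff' hF).2 (ae_of_all _ fun s hs => ?_)
      have h1 : Tendsto (fun R : ℝ => R * s) atTop atTop := tendsto_id.atTop_mul_const (hF0 hs)
      simpa using (hlim.comp h1).const_mul (ψ s)
  have htot := (herr.add (hcos.const_mul A)).add (hsin.const_mul B)
  simp only [mul_zero, add_zero] at htot
  refine htot.congr' ?_
  filter_upwards [eventually_ge_atTop 0] with R hR
  have i1 : ∀ w : ℝ → ℝ, Continuous w → (∀ x, |w x| ≤ 1) →
      IntegrableOn (fun s => ψ s * w (R * s)) F := fun w hw hb =>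
    hψ.mul_bdd (c := 1) (by fun_prop : Continuous _).aestronglyMeasurable
      (ae_of_all _ fun s => hb _)
  have i2 : IntegrableOn (fun s => ψ s * (v (R * s) - q (R * s))) F :=
    hψ.mul_bdd (c := C + (|A| + |B|)) (by fun_prop : Continuous _).aestronglyMeasurable
      ((ae_restrict_iff' hF).2 (ae_of_all _ fun s hs => (abs_sub _ _).trans
        (add_le_add (hC _ (mul_nonneg hR (le_of_lt (hF0 hs)))) (hqb _))))
  have i3 := (i1 _ Real.continuous_cos abs_cos_le_one).const_mul A
  have i4 := (i1 _ Real.continuous_sin abs_sin_le_one).const_mul B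
  have i5 : IntegrableOn
      (fun s => ψ s * (v (R * s) - q (R * s)) + A * (ψ s * Real.cos (R * s))) F := i2.add i3
  rw [← integral_const_mul, ← integral_const_mul, ← integral_add i2 i3, ← integral_add i5 i4]
  refine integral_congr_ae (ae_of_all _ fun s => ?_)
  simp only [hq]
  ring

lemma abs_integral_sinc_le (x : ℝ) : |∫ t in (0:ℝ)..x, sinc t| ≤ 4 := by
  wlog hx : 0 ≤ x generalizing x
  · have h := this (-x) (by linarith)
    have e := intervalIntegral.integral_comp_neg (a := 0) (b := x) sinc
    simp only [sinc_neg, neg_zero] at e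
    rwa [e, intervalIntegral.integral_symm, abs_neg]
  have hc := continuous_sinc
  have hsmall : ∀ y, 0 ≤ y → y ≤ 1 → |∫ t in (0:ℝ)..y, sinc t| ≤ 1 := by
    intro y hy0 hy1
    have := intervalIntegral.norm_integral_le_of_norm_le_const (a := 0) (b := y) (f := sinc)
      (C := 1) (fun t _ => abs_sinc_le_one t)
    rw [sub_zero, one_mul, abs_of_nonneg hy0] at this
    exact this.trans hy1
  rcases le_total x 1 with h1 | h1
  · linarith [hsmall x hx h1]
  have hpos : ∀ t ∈ Set.uIcc 1 x, 0 < t := by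
    intro t ht
    rw [Set.uIcc_of_le h1] at ht
    linarith [ht.1]
  have key : ∫ t in (1:ℝ)..x, (sinc t + Real.cos t / t ^ 2) =
      -(Real.cos x / x) - -(Real.cos 1 / 1) := by
    refine intervalIntegral.integral_eq_sub_of_hasDerivAt (f := fun t => -(Real.cos t / t))
      (fun t ht => ?_) ?_
    · have ht0 := hpos t ht
      convert! ((Real.hasDerivAt_cos t).div (hasDerivAt_id t) ht0.ne').neg using 1
      rw [sinc_of_ne_zero ht0.ne']
      simp
      field_simp
      ring
    · refine ContinuousOn.intervalIntegrable fun t ht => ?_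
      have ht0 := (hpos t ht).ne'
      exact (hc.continuousAt.add (Real.continuous_cos.continuousAt.div
        (continuousAt_id.pow 2) (pow_ne_zero 2 ht0))).continuousWithinAt
  have i2 : IntervalIntegrable (fun t => Real.cos t / t ^ 2) volume 1 x := by
    refine ContinuousOn.intervalIntegrable fun t ht => ?_
    exact (Real.continuous_cos.continuousAt.div
        (continuousAt_id.pow 2) (pow_ne_zero 2 (hpos t ht).ne')).continuousWithinAt
  have i3 : IntervalIntegrable (fun t : ℝ => 1 / t ^ 2) volume 1 x := by
    refine ContinuousOn.intervalIntegrable fun t ht => ?_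
    exact (continuousAt_const.div
        (continuousAt_id.pow 2) (pow_ne_zero 2 (hpos t ht).ne')).continuousWithinAt
  rw [intervalIntegral.integral_add (hc.intervalIntegrable _ _) i2] at key
  have h4 : ∫ t in (1:ℝ)..x, 1 / t ^ 2 = -(1 / x) - -(1 / 1) := by
    refine intervalIntegral.integral_eq_sub_of_hasDerivAt (f := fun t => -(1 / t))
      (fun t ht => ?_) i3
    have ht0 := hpos t ht
    convert! ((hasDerivAt_const t (1:ℝ)).div (hasDerivAt_id t) ht0.ne').neg using 1
    simp [neg_div]
  have h5 : |∫ t in (1:ℝ)..x, Real.cos t / t ^ 2| ≤ ∫ t in (1:ℝ)..x, 1 / t ^ 2 := by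
    refine intervalIntegral.norm_integral_le_of_norm_le (f := fun t => Real.cos t / t ^ 2) h1
      (ae_of_all _ fun t _ => ?_) i3
    rw [Real.norm_eq_abs, abs_div, abs_of_nonneg (sq_nonneg t)]
    gcongr
    exact abs_cos_le_one t
  have h6 : |Real.cos x / x| ≤ 1 := by
    rw [abs_div, abs_of_nonneg hx, div_le_one (by linarith)]
    exact (abs_cos_le_one x).trans h1
  have h7 : 0 < 1 / x := by positivity
  have h8 := abs_le.1 (abs_cos_le_one 1)
  rw [h4] at h5
  rw [← intervalIntegral.integral_add_adjacent_intervals (hc.intervalIntegrable 0 1)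
    (hc.intervalIntegrable 1 x)]
  have h9 := abs_le.1 (hsmall 1 zero_le_one le_rfl)
  rw [abs_le] at h5 h6 ⊢
  constructor <;> linarith

lemma abs_integral_mul_sinc_le (R r a b : ℝ) :
    |∫ s in a..b, R * sinc (R * (s - r))| ≤ 8 := by
  have h : ∫ s in a..b, R * sinc (R * (s - r)) = ∫ t in (R * (a - r))..(R * (b - r)), sinc t := by
    rw [intervalIntegral.integral_const_mul,
      intervalIntegral.integral_comp_sub_right (fun t => sinc (R * t)) r,
      intervalIntegral.mul_integral_comp_mul_left]
  have hc := continuous_sinc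
  rw [h, ← intervalIntegral.integral_add_adjacent_intervals (hc.intervalIntegrable _ 0)
    (hc.intervalIntegrable 0 _), intervalIntegral.integral_symm]
  have h1 := abs_le.1 (abs_integral_sinc_le (R * (a - r)))
  have h2 := abs_le.1 (abs_integral_sinc_le (R * (b - r)))
  rw [abs_le]
  constructor <;> linarith

lemma sum_sub_mul_sub_eq (x H : ℕ → ℝ) (k : ℝ) (n : ℕ) :
    ∑ i ∈ Finset.range n, (x i - k) * (H i - H (i + 1)) =
      (x 0 - k) * H 0 + ∑ i ∈ Finset.range n, (x (i + 1) - x i) * H (i + 1) -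
        (x n - k) * H n := by
  induction n with
  | zero => simp
  | succ n ih =>
    rw [Finset.sum_range_succ, ih, Finset.sum_range_succ]
    ring

/-- A substitute for the second mean value theorem for integrals. -/
lemma abs_integral_sub_mul_le {φ g : ℝ → ℝ} {a b C : ℝ} (k : ℝ) (hab : a ≤ b)
    (hφ : ContinuousOn φ (Set.Icc a b)) (hv : BoundedVariationOn φ (Set.Icc a b))
    (hg : Continuous g) (hC : ∀ x y, |∫ s in x..y, g s| ≤ C) :
    |∫ s in a..b, (φ s - k) * g s| ≤
      C * (|φ a - k| + (eVariationOn φ (Set.Icc a b)).toReal) := by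
  have hC0 : 0 ≤ C := (abs_nonneg _).trans (hC a a)
  obtain ⟨G, hG⟩ := isCompact_Icc.exists_bound_of_continuousOn (s := Set.Icc a b) hg.continuousOn
  have hG0 : 0 ≤ G := (norm_nonneg _).trans (hG a ⟨le_rfl, hab⟩)
  refine le_of_forall_pos_le_add fun ε hε => ?_
  have huc := Metric.uniformContinuousOn_iff.1 (isCompact_Icc.uniformContinuousOn_of_continuous hφ)
  obtain ⟨δ, hδ, hδ'⟩ := huc (ε / (G * (b - a) + 1)) (by
    have : 0 ≤ G * (b - a) := mul_nonneg hG0 (by linarith)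
    positivity)
  obtain ⟨n, hn⟩ := exists_nat_gt ((b - a) / δ)
  have hn0 : (0:ℝ) < n := lt_of_le_of_lt (div_nonneg (by linarith) hδ.le) hn
  set h : ℝ := (b - a) / n with hh
  have hh0 : 0 ≤ h := div_nonneg (by linarith) hn0.le
  have hnh : n * h = b - a := by rw [hh]; field_simp
  have hhδ : h < δ := by rw [hh, div_lt_comm₀ hn0 hδ]; exact hn
  set t : ℕ → ℝ := fun i => a + i * h with ht
  have ht0 : t 0 = a := by simp [ht]
  have htn : t n = b := by simp only [ht]; linarith
  have hts : ∀ i, t (i + 1) = t i + h := fun i => by simp only [ht]; push_cast; ring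
  have htm : Monotone t := monotone_nat_of_le_succ fun i => by rw [hts]; linarith
  have htI : ∀ i, i ≤ n → t i ∈ Set.Icc a b := fun i hi =>
    ⟨ht0 ▸ htm (Nat.zero_le i), htn ▸ htm hi⟩
  have hvar : ∑ i ∈ Finset.range n, |φ (t (i + 1)) - φ (t i)| ≤
      (eVariationOn φ (Set.Icc a b)).toReal := by
    have := eVariationOn.sum_le_of_monotoneOn_Icc (f := φ) (s := Set.Icc a b) (m := 0) (n := n)
      (u := t) (htm.monotoneOn _) fun i hi => htI i hi.2
    rw [← ENNReal.ofReal_le_iff_le_toReal hv,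
      ENNReal.ofReal_sum_of_nonneg fun _ _ => abs_nonneg _]
    simpa [edist_dist, Real.dist_eq] using this
  have hgi : ∀ x y, IntervalIntegrable g volume x y := fun x y => hg.intervalIntegrable x y
  have hφi : ∀ i < n, IntervalIntegrable (fun s => (φ s - k) * g s) volume (t i) (t (i + 1)) := by
    intro i hi
    refine ContinuousOn.intervalIntegrable_of_Icc (htm i.le_succ) ?_
    exact ((hφ.mono (Set.Icc_subset_Icc (htI i hi.le).1 (htI (i + 1) hi).2)).sub
      continuousOn_const).mul hg.continuousOn
  have hsum := intervalIntegral.sum_integral_adjacent_intervals hφi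
  have hstep : ∀ i ∈ Finset.range n, |(∫ s in t i..t (i + 1), (φ s - k) * g s) -
      (φ (t i) - k) * ((∫ s in t i..b, g s) - ∫ s in t (i + 1)..b, g s)| ≤
        ε / (G * (b - a) + 1) * G * h := by
    intro i hi
    have hi := Finset.mem_range.1 hi
    rw [← intervalIntegral.integral_add_adjacent_intervals (hgi (t i) (t (i + 1))) (hgi _ b),
      add_sub_cancel_right, ← intervalIntegral.integral_const_mul,
      ← intervalIntegral.integral_sub (hφi i hi) ((hgi _ _).const_mul _)]
    have := intervalIntegral.norm_integral_le_of_norm_le_const (a := t i) (b := t (i + 1))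
      (f := fun s => (φ s - k) * g s - (φ (t i) - k) * g s) (C := ε / (G * (b - a) + 1) * G) ?_
    · rwa [hts, add_sub_cancel_left, abs_of_nonneg hh0, ← hts] at this
    · intro s hs
      rw [Set.uIoc_of_le (htm i.le_succ)] at hs
      have hsI : s ∈ Set.Icc a b := ⟨(htI i hi.le).1.trans hs.1.le, hs.2.trans (htI (i + 1) hi).2⟩
      have hd := hδ' s hsI (t i) (htI i hi.le) (by
        have := hts i
        rw [Real.dist_eq, abs_of_nonneg (by linarith [hs.1])]
        linarith [hs.2])
      rw [← sub_mul, sub_sub_sub_cancel_right, norm_mul]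
      exact mul_le_mul hd.le (hG s hsI) (norm_nonneg _) ((abs_nonneg _).trans hd.le)
  have habel := sum_sub_mul_sub_eq (fun i => φ (t i)) (fun i => ∫ s in t i..b, g s) k n
  simp only [htn, ht0, intervalIntegral.integral_same, mul_zero, sub_zero] at habel hsum
  have h1 : |(∫ s in a..b, (φ s - k) * g s) - ∑ i ∈ Finset.range n,
      (φ (t i) - k) * ((∫ s in t i..b, g s) - ∫ s in t (i + 1)..b, g s)| ≤ ε := by
    rw [← hsum, ← Finset.sum_sub_distrib]
    refine (Finset.abs_sum_le_sum_abs _ _).trans ((Finset.sum_le_sum hstep).trans ?_)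
    rw [Finset.sum_const, Finset.card_range, nsmul_eq_mul]
    have h2 : 0 ≤ G * (b - a) := mul_nonneg hG0 (by linarith)
    calc (n:ℝ) * (ε / (G * (b - a) + 1) * G * h)
        = ε * ((G * (b - a)) / (G * (b - a) + 1)) := by rw [← hnh]; ring
      _ ≤ ε * 1 := by
        refine mul_le_mul_of_nonneg_left ?_ hε.le
        rw [div_le_one (by linarith)]
        linarith
      _ = ε := mul_one ε
  have h2 : |∑ i ∈ Finset.range n, (φ (t (i + 1)) - φ (t i)) * ∫ s in t (i + 1)..b, g s| ≤
      C * (eVariationOn φ (Set.Icc a b)).toReal := by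
    refine (Finset.abs_sum_le_sum_abs _ _).trans (le_trans ?_ (mul_le_mul_of_nonneg_left hvar hC0))
    rw [Finset.mul_sum]
    refine Finset.sum_le_sum fun i _ => ?_
    rw [abs_mul, mul_comm]
    exact mul_le_mul_of_nonneg_right (hC _ _) (abs_nonneg _)
  have h3 : |(φ a - k) * ∫ s in a..b, g s| ≤ C * |φ a - k| := by
    rw [abs_mul, mul_comm]
    exact mul_le_mul_of_nonneg_right (hC _ _) (abs_nonneg _)
  rw [habel] at h1
  rw [abs_le] at h1 h2 h3 ⊢
  constructor <;> linarith

lemma BoundedVariationOn.exists_abs_integral_sub_mul_le {φ : ℝ → ℝ} {r ρ : ℝ} (hρ : 0 < ρ)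
    (hφ : ContinuousOn φ (Set.Icc (r - ρ) (r + ρ)))
    (hv : BoundedVariationOn φ (Set.Icc (r - ρ) (r + ρ))) (C : ℝ) {ε : ℝ} (hε : 0 < ε) :
    ∃ δ₀ > 0, ∀ δ, 0 < δ → δ ≤ δ₀ → ∀ g : ℝ → ℝ, Continuous g →
      (∀ x y, |∫ s in x..y, g s| ≤ C) →
        |∫ s in (r - δ)..(r + δ), (φ s - φ r) * g s| ≤ ε := by
  have hr : r ∈ Set.Icc (r - ρ) (r + ρ) := ⟨by linarith, by linarith⟩
  have hs : Set.Icc (r - ρ) (r + ρ) ∈ 𝓝 r := Icc_mem_nhds (by linarith) (by linarith)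
  have hl := hv.tendsto_eVariationOn_Icc_zero_left (x := r) ((hφ r hr).mono Set.inter_subset_left)
  have hrt := hv.tendsto_eVariationOn_Icc_zero_right r ((hφ r hr).mono Set.inter_subset_left)
  rw [nhdsWithin_eq_nhds.2 hs] at hl hrt
  set η := ε / (4 * (|C| + 1)) with hη
  have hη0 : 0 < η := by positivity
  have hev := (hl.eventually (gt_mem_nhds (ENNReal.ofReal_pos.2 hη0))).and
    (hrt.eventually (gt_mem_nhds (ENNReal.ofReal_pos.2 hη0)))
  obtain ⟨κ, hκ, hκ'⟩ := Metric.eventually_nhds_iff.1 hev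
  refine ⟨min ρ (κ / 2), lt_min hρ (by linarith), fun δ hδ hδ' g hg hC => ?_⟩
  have hδρ := hδ'.trans (min_le_left _ _)
  have hδκ := hδ'.trans (min_le_right _ _)
  have hsub : Set.Icc (r - δ) (r + δ) ⊆ Set.Icc (r - ρ) (r + ρ) :=
    Set.Icc_subset_Icc (by linarith) (by linarith)
  have h1 := (hκ' (y := r - δ) (by rw [Real.dist_eq, abs_lt]; constructor <;> linarith)).1
  have h2 := (hκ' (y := r + δ) (by rw [Real.dist_eq, abs_lt]; constructor <;> linarith)).2
  rw [Set.inter_eq_right.2 (Set.Icc_subset_Icc (by linarith) (by linarith))] at h1 h2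
  have hsplit := eVariationOn.Icc_add_Icc φ (s := Set.univ) (a := r - δ) (b := r) (c := r + δ)
    (by linarith) (by linarith) (Set.mem_univ r)
  simp only [Set.univ_inter] at hsplit
  have hvar : (eVariationOn φ (Set.Icc (r - δ) (r + δ))).toReal ≤ 2 * η := by
    refine ENNReal.toReal_le_of_le_ofReal (by linarith) ?_
    rw [← hsplit, two_mul, ENNReal.ofReal_add hη0.le hη0.le]
    exact add_le_add h1.le h2.le
  have hd := (hv.mono hsub).dist_le (x := r - δ) (y := r) ⟨le_rfl, by linarith⟩
    ⟨by linarith, by linarith⟩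
  rw [Real.dist_eq] at hd
  have hC0 : 0 ≤ C := (abs_nonneg _).trans (hC 0 0)
  refine (abs_integral_sub_mul_le (φ r) (by linarith) (hφ.mono hsub) (hv.mono hsub) hg hC).trans ?_
  calc _ ≤ C * (4 * η) := mul_le_mul_of_nonneg_left (by linarith) hC0
    _ = ε * (C / (C + 1)) := by rw [hη, abs_of_nonneg hC0]; field_simp
    _ ≤ ε * 1 := by
      refine mul_le_mul_of_nonneg_left ?_ hε.le
      rw [div_le_one (by linarith)]
      linarith
    _ = ε := mul_one ε

/-- The kernel of the truncated Hankel inversion formula. -/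
noncomputable def hankelKernel (r R s : ℝ) : ℝ :=
  s * ∫ p in (0:ℝ)..R, J0 (p * s) * J0 (p * r) * p

lemma continuous_hankelKernel (r R : ℝ) : Continuous (hankelKernel r R) := by
  have := continuous_J0
  refine continuous_id.mul ?_
  exact intervalIntegral.continuous_parametric_intervalIntegral_of_continuous' (by fun_prop) _ _

lemma sqrt_mul_hankelKernel {r R s : ℝ} (hs : 0 < s) (hR : 0 ≤ R) :
    (s ^ 2 - r ^ 2) * (√r * hankelKernel r R s) = √s *
      (s * (besselV (R * s) * besselU (R * r)) - r * (besselU (R * s) * besselV (R * r))) := by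
  have h := integral_J0_mul_J0 r s R
  have h1 := Real.mul_self_sqrt hs.le
  have h2 := Real.mul_self_sqrt hR
  unfold hankelKernel besselU besselV
  rw [Real.sqrt_mul hR, Real.sqrt_mul hR]
  linear_combination s * √r * h -
    √r * (√R * √R) * (s * J1 (R * s) * J0 (R * r) - r * J0 (R * s) * J1 (R * r)) * h1 -
    √r * s * (s * J1 (R * s) * J0 (R * r) - r * J0 (R * s) * J1 (R * r)) * h2

lemma abs_hankelKernel_sub_le {r R s : ℝ} (hr : 0 < r) (hR : 2 / r ≤ R) (hs : |s - r| ≤ r / 2)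
    (hne : s ≠ r) :
    |hankelKernel r R s - (besselA (R * r) ^ 2 + besselB (R * r) ^ 2) / 2 *
      (R * sinc (R * (s - r)))| ≤ 136 / r := by
  have hs' := abs_le.1 hs
  have hs0 : 0 < s := by linarith
  have hR0 : 0 < R := lt_of_lt_of_le (by positivity) hR
  have hRr : 2 ≤ R * r := by rwa [div_le_iff₀ hr] at hR
  have hd : s - r ≠ 0 := sub_ne_zero.2 hne
  have hRs : 0 < R * s := by positivity
  have hK := sqrt_mul_hankelKernel (r := r) hs0 hR0.le
  rw [besselV_eq (by positivity), besselV_eq (by positivity)] at hK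
  have hU : |besselU (R * s)| ≤ 2 := abs_besselU_le _
  have hW : |besselW (R * r)| ≤ 2 := abs_besselW_le (by linarith)
  have hA : |besselA (R * r)| ≤ 4 := abs_besselA_le (by linarith)
  have hB : |besselB (R * r)| ≤ 4 := abs_besselB_le (by linarith)
  have hm : 1 / (R * r / 2) ^ 2 * |R * s - R * r| ≤ 2 / r * |s - r| := by
    rw [← mul_sub, abs_mul, abs_of_pos hR0, ← mul_assoc]
    refine mul_le_mul_of_nonneg_right ?_ (abs_nonneg _)
    rw [show 1 / (R * r / 2) ^ 2 * R = 2 / r * (2 / (R * r)) by field_simp]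
    refine mul_le_of_le_one_right (by positivity) ?_
    rwa [div_le_one (by linarith)]
  have hms : R * r / 2 ≤ R * s := by nlinarith
  have hdA := (abs_besselA_sub_le (m := R * r / 2) (x := R * r) (y := R * s) (by linarith)
    (by linarith) hms).trans hm
  have hdB := (abs_besselB_sub_le (m := R * r / 2) (x := R * r) (y := R * s) (by linarith)
    (by linarith) hms).trans hm
  have hq1 : |√s / √r - 1| ≤ |s - r| / r := by
    have h1 := Real.mul_self_sqrt hs0.le
    have h2 := Real.mul_self_sqrt hr.le
    have h3 := Real.sqrt_pos.2 hs0
    have h4 := Real.sqrt_pos.2 hr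
    rw [show √s / √r - 1 = (s - r) / (√r * (√s + √r)) by
      field_simp
      linear_combination h1 - h2, abs_div, abs_of_pos (by positivity : 0 < √r * (√s + √r))]
    refine div_le_div_of_nonneg_left (abs_nonneg _) hr ?_
    nlinarith
  have hq : |√s / √r| ≤ 2 := by
    have h1 : |s - r| / r ≤ 1 / 2 := by rw [div_le_iff₀ hr]; linarith
    have := abs_add_le (√s / √r - 1) 1
    rw [sub_add_cancel, abs_one] at this
    linarith
  have hw : |s / (s + r)| ≤ 1 := by
    rw [abs_of_pos (by positivity), div_le_one (by positivity)]
    linarith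
  have hw1 : |s / (s + r) - 1 / 2| ≤ |s - r| / r := by
    rw [show s / (s + r) - 1 / 2 = (s - r) / (2 * (s + r)) by field_simp; ring, abs_div,
      abs_of_pos (by positivity : 0 < 2 * (s + r))]
    exact div_le_div_of_nonneg_left (abs_nonneg _) hr (by linarith)
  have hS : |Real.sin (R * s - R * r)| ≤ 1 := abs_sin_le_one _
  have hT : |Real.cos (R * s - R * r)| ≤ 1 := abs_cos_le_one _
  have mm : ∀ {x y a b : ℝ}, |x| ≤ a → |y| ≤ b → |x * y| ≤ a * b := fun hx hy =>
    (abs_mul _ _).trans_le (mul_le_mul hx hy (abs_nonneg _) ((abs_nonneg _).trans hx))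
  have aa : ∀ {x y a b : ℝ}, |x| ≤ a → |y| ≤ b → |x + y| ≤ a + b := fun hx hy =>
    (abs_add_le _ _).trans (add_le_add hx hy)
  have ss : ∀ {x y a b : ℝ}, |x| ≤ a → |y| ≤ b → |x - y| ≤ a + b := fun hx hy =>
    (abs_sub _ _).trans (add_le_add hx hy)
  have hid : hankelKernel r R s - (besselA (R * r) ^ 2 + besselB (R * r) ^ 2) / 2 *
      (R * sinc (R * (s - r))) = √s / √r * (besselU (R * s) * besselW (R * r)) * (1 / (s + r)) +
        ((√s / √r * (s / (s + r)) * ((besselA (R * s) - besselA (R * r)) * besselA (R * r) +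
              (besselB (R * s) - besselB (R * r)) * besselB (R * r)) +
            ((√s / √r - 1) * (s / (s + r)) + (s / (s + r) - 1 / 2)) *
              (besselA (R * r) * besselA (R * r) + besselB (R * r) * besselB (R * r))) *
            Real.sin (R * s - R * r) +
          √s / √r * (s / (s + r)) * ((besselA (R * s) - besselA (R * r)) * besselB (R * r) -
              (besselB (R * s) - besselB (R * r)) * besselA (R * r)) *
            Real.cos (R * s - R * r)) / (s - r) := by
    have h4 := (Real.sqrt_pos.2 hr).ne'
    have hsr : s + r ≠ 0 := by positivity
    have hK' : hankelKernel r R s = √s / √r * (s * (besselW (R * s) * besselU (R * r)) -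
        r * (besselU (R * s) * besselW (R * r))) / ((s - r) * (s + r)) := by
      rw [eq_div_iff (mul_ne_zero hd hsr), div_mul_eq_mul_div, eq_div_iff h4]
      have e1 : s * (besselU (R * s) / (2 * (R * s)) * besselU (R * r)) =
          r * (besselU (R * s) * (besselU (R * r) / (2 * (R * r)))) := by
        field_simp
      linear_combination hK + √s * e1
    rw [hK', sinc_of_ne_zero (mul_ne_zero hR0.ne' hd)]
    have e2 : R * (Real.sin (R * (s - r)) / (R * (s - r))) = Real.sin (R * (s - r)) / (s - r) := by
      field_simp
    rw [e2, mul_sub R s r, Real.sin_sub, Real.cos_sub, besselU_eq (R * r), besselU_eq (R * s),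
      besselW_eq (R * r), besselW_eq (R * s)]
    field_simp
    ring
  set e := |s - r| / r with he
  have hdA' : |besselA (R * s) - besselA (R * r)| ≤ 2 * e := 
    hdA.trans_eq (by rw [he]; ring)
  have hdB' : |besselB (R * s) - besselB (R * r)| ≤ 2 * e := 
    hdB.trans_eq (by rw [he]; ring)
  have hsr : |1 / (s + r)| ≤ 1 / r := by
    rw [abs_of_pos (by positivity)]
    exact one_div_le_one_div_of_le hr (by linarith)
  have hnum := aa (mm (aa (mm (mm hq hw) (aa (mm hdA' hA) (mm hdB' hB)))
    (mm (aa (mm hq1 hw) hw1) (aa (mm hA hA) (mm hB hB)))) hS)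
    (mm (mm (mm hq hw) (ss (mm hdA' hB) (mm hdB' hA))) hT)
  rw [hid]
  refine (aa (mm (mm hq (mm hU hW)) hsr) (?_ : _ ≤ 128 / r)).trans (le_of_eq (by ring))
  rw [abs_div, div_le_iff₀ (abs_pos.2 hd)]
  refine hnum.trans (le_of_eq ?_)
  rw [he]
  ring

lemma BoundedVariationOn.exists_abs_integral_sub_mul_hankelKernel_le {φ : ℝ → ℝ} {r : ℝ}
    (hr : 0 < r) (hφ : ContinuousOn φ (Set.Icc (r - r / 2) (r + r / 2)))
    (hv : BoundedVariationOn φ (Set.Icc (r - r / 2) (r + r / 2))) {ε : ℝ} (hε : 0 < ε) :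
    ∃ δ₀ > 0, ∀ δ, 0 < δ → δ ≤ δ₀ → ∀ R, 2 / r ≤ R →
      |∫ s in (r - δ)..(r + δ), (φ s - φ r) * hankelKernel r R s| ≤ ε := by
  obtain ⟨δ₁, hδ₁, h1⟩ := hv.exists_abs_integral_sub_mul_le (half_pos hr) hφ 128 (half_pos hε)
  have hr' : Set.Icc (r - r / 2) (r + r / 2) ∈ 𝓝 r := Icc_mem_nhds (by linarith) (by linarith)
  obtain ⟨δ₂, hδ₂, h2⟩ := Metric.continuousAt_iff.1 (hφ.continuousAt hr') (ε / 272) (by positivity)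
  refine ⟨min (min δ₁ (δ₂ / 2)) (r / 2), by positivity, fun δ hδ hδ' R hR => ?_⟩
  have hδr := hδ'.trans (min_le_right _ _)
  have hδ1 := (hδ'.trans (min_le_left _ _)).trans (min_le_left _ _)
  have hδ2 := (hδ'.trans (min_le_left _ _)).trans (min_le_right _ _)
  have hRr : 2 ≤ R * r := by rwa [div_le_iff₀ hr] at hR
  set c := (besselA (R * r) ^ 2 + besselB (R * r) ^ 2) / 2 with hc
  have hc0 : 0 ≤ c := by positivity
  have hc16 : c ≤ 16 := by
    have hA := sq_le_sq' (abs_le.1 (abs_besselA_le (x := R * r) (by linarith))).1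
      (abs_le.1 (abs_besselA_le (x := R * r) (by linarith))).2
    have hB := sq_le_sq' (abs_le.1 (abs_besselB_le (x := R * r) (by linarith))).1
      (abs_le.1 (abs_besselB_le (x := R * r) (by linarith))).2
    linarith
  have hsc := continuous_sinc
  have hkc := continuous_hankelKernel r R
  have hg := h1 δ hδ hδ1 (fun s => c * (R * sinc (R * (s - r)))) (by fun_prop) fun x y => by
    rw [intervalIntegral.integral_const_mul, abs_mul, abs_of_nonneg hc0]
    have := mul_le_mul hc16 (abs_integral_mul_sinc_le R r x y) (abs_nonneg _) (by norm_num)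
    linarith
  have hφI : ContinuousOn φ (Set.Icc (r - δ) (r + δ)) :=
    hφ.mono (Set.Icc_subset_Icc (by linarith) (by linarith))
  have hint : ∀ g : ℝ → ℝ, Continuous g →
      IntervalIntegrable (fun s => (φ s - φ r) * g s) volume (r - δ) (r + δ) := fun g hg =>
    ((hφI.sub continuousOn_const).mul hg.continuousOn).intervalIntegrable_of_Icc (by linarith)
  have hsub : |(∫ s in (r - δ)..(r + δ), (φ s - φ r) * hankelKernel r R s) -
      ∫ s in (r - δ)..(r + δ), (φ s - φ r) * (c * (R * sinc (R * (s - r))))| ≤ ε / 2 := by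
    rw [← intervalIntegral.integral_sub (hint _ hkc) (hint _ (by fun_prop)), ← Real.norm_eq_abs]
    refine (intervalIntegral.norm_integral_le_of_norm_le_const
      (C := ε / 272 * (136 / r)) fun s hs => ?_).trans ?_
    · rw [Set.uIoc_of_le (by linarith)] at hs
      rw [← mul_sub, norm_mul]
      have hsr : |s - r| ≤ δ := abs_le.2 ⟨by linarith [hs.1], by linarith [hs.2]⟩
      rcases eq_or_ne s r with rfl | hne
      · simp only [sub_self, norm_zero, zero_mul]
        positivity
      · refine mul_le_mul (h2 ?_).le (abs_hankelKernel_sub_le hr hR (hsr.trans hδr) hne)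
          (norm_nonneg _) (by positivity)
        rw [Real.dist_eq]
        linarith
    · rw [abs_of_nonneg (by linarith)]
      have : ε / 272 * (136 / r) * (r + δ - (r - δ)) = ε / 2 * (2 * δ / r) := by ring
      rw [this]
      refine mul_le_of_le_one_right (by positivity) ?_
      rw [div_le_one hr]
      linarith
  rw [abs_le] at hg hsub ⊢
  constructor <;> linarith

lemma integrableOn_mul_sqrt {φ : ℝ → ℝ} (hφ : ContinuousOn φ (Set.Ioi 0))
    (hint : IntegrableOn (fun s => |φ s| * √s) (Set.Ioi 0)) :
    IntegrableOn (fun s => φ s * √s) (Set.Ioi 0) := by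
  refine Integrable.mono hint ?_ (ae_of_all _ fun s => by simp)
  exact (hφ.mul Real.continuous_sqrt.continuousOn).aestronglyMeasurable measurableSet_Ioi

lemma tendsto_setIntegral_mul_hankelKernel {φ : ℝ → ℝ} {r δ : ℝ} (hr : 0 < r) (hδ : 0 < δ)
    (hint : IntegrableOn (fun s => φ s * √s) (Set.Ioi 0)) :
    Tendsto (fun R => ∫ s in Set.Ioi 0 \ Set.Ioc (r - δ) (r + δ), φ s * hankelKernel r R s)
      atTop (𝓝 0) := by
  set F := Set.Ioi (0:ℝ) \ Set.Ioc (r - δ) (r + δ) with hFdef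
  have hF : MeasurableSet F := measurableSet_Ioi.diff measurableSet_Ioc
  have hF0 : F ⊆ Set.Ioi 0 := Set.sdiff_subset
  have hintF : IntegrableOn (fun s => φ s * √s) F := hint.mono_set hF0
  have hlow : ∀ s ∈ F, 0 < s ∧ δ * (s + r) ≤ |s ^ 2 - r ^ 2| := by
    intro s hs
    have hs0 : 0 < s := hs.1
    refine ⟨hs0, ?_⟩
    rw [show s ^ 2 - r ^ 2 = (s - r) * (s + r) by ring, abs_mul, abs_of_pos (by linarith : 0 < s + r)]
    refine mul_le_mul_of_nonneg_right ?_ (by linarith)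
    by_contra! hlt
    rw [abs_lt] at hlt
    exact hs.2 ⟨by linarith, by linarith⟩
  have i1 : IntegrableOn (fun s => φ s * √s * (s / (s ^ 2 - r ^ 2))) F := by
    refine hintF.mul_bdd (c := 1 / δ) (by fun_prop : Measurable _).aestronglyMeasurable
      ((ae_restrict_iff' hF).2 (ae_of_all _ fun s hs => ?_))
    obtain ⟨h0, h1⟩ := hlow s hs
    rw [Real.norm_eq_abs, abs_div, abs_of_pos h0,
      div_le_div_iff₀ (lt_of_lt_of_le (by positivity) h1) hδ]
    nlinarith
  have i2 : IntegrableOn (fun s => φ s * √s * (1 / (s ^ 2 - r ^ 2))) F := by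
    refine hintF.mul_bdd (c := 1 / (δ * r)) (by fun_prop : Measurable _).aestronglyMeasurable
      ((ae_restrict_iff' hF).2 (ae_of_all _ fun s hs => ?_))
    obtain ⟨h0, h1⟩ := hlow s hs
    rw [Real.norm_eq_abs, abs_div, abs_one]
    refine one_div_le_one_div_of_le (by positivity) (le_trans ?_ h1)
    nlinarith
  have hUc := continuous_besselU
  have hVc := continuous_besselV
  obtain ⟨A, B, hU⟩ := exists_asymptotic_besselU
  obtain ⟨A', B', hV⟩ := exists_asymptotic_besselV
  have t1 := tendsto_setIntegral_mul_comp_mul hF hF0 i1 hVc (fun x _ => abs_besselV_le x) hV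
  have t2 := tendsto_setIntegral_mul_comp_mul hF hF0 i2 hUc (fun x _ => abs_besselU_le x) hU
  have t3 := ((t1.abs.const_mul 2).add ((t2.abs.const_mul 3).const_mul r)).const_mul (1 / √r)
  simp only [abs_zero, mul_zero, add_zero] at t3
  refine squeeze_zero_norm' ?_ t3
  filter_upwards [eventually_ge_atTop 0] with R hR
  have h4 := Real.sqrt_pos.2 hr
  have hid : ∫ s in F, φ s * hankelKernel r R s = 1 / √r *
      (besselU (R * r) * (∫ s in F, φ s * √s * (s / (s ^ 2 - r ^ 2)) * besselV (R * s)) -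
        r * (besselV (R * r) * ∫ s in F, φ s * √s * (1 / (s ^ 2 - r ^ 2)) * besselU (R * s))) := by
    have j1 := i1.mul_bdd (c := 3) (by fun_prop : Continuous
      (fun s => besselV (R * s))).aestronglyMeasurable (ae_of_all _ fun s => abs_besselV_le _)
    have j2 := i2.mul_bdd (c := 2) (by fun_prop : Continuous
      (fun s => besselU (R * s))).aestronglyMeasurable (ae_of_all _ fun s => abs_besselU_le _)
    rw [← integral_const_mul, ← integral_const_mul, ← integral_const_mul,
      ← integral_sub (j1.const_mul _) ((j2.const_mul _).const_mul _), ← integral_const_mul]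
    refine setIntegral_congr_fun hF fun s hs => ?_
    obtain ⟨h0, h1⟩ := hlow s hs
    have h5 : s ^ 2 - r ^ 2 ≠ 0 := abs_pos.1 (lt_of_lt_of_le (by positivity) h1)
    have hK := sqrt_mul_hankelKernel (r := r) h0 hR
    have hK' : hankelKernel r R s = √s * (s * (besselV (R * s) * besselU (R * r)) -
        r * (besselU (R * s) * besselV (R * r))) / ((s ^ 2 - r ^ 2) * √r) := by
      rw [eq_div_iff (mul_ne_zero h5 h4.ne')]
      linear_combination hK
    simp only [hK']
    field_simp
  rw [hid, norm_mul, Real.norm_of_nonneg (by positivity)]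
  refine mul_le_mul_of_nonneg_left ((abs_sub _ _).trans (add_le_add ?_ ?_)) (by positivity)
  · rw [abs_mul]
    exact mul_le_mul_of_nonneg_right (abs_besselU_le _) (abs_nonneg _)
  · rw [abs_mul, abs_mul, abs_of_pos hr]
    exact mul_le_mul_of_nonneg_left
      (mul_le_mul_of_nonneg_right (abs_besselV_le _) (abs_nonneg _)) hr.le

lemma integrableOn_and_integral_hankel_eq {φ : ℝ → ℝ} {r R : ℝ} (hR : 0 ≤ R)
    (hint : IntegrableOn (fun s => φ s * √s) (Set.Ioi 0)) :
    IntegrableOn (fun s => φ s * hankelKernel r R s) (Set.Ioi 0) ∧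
      ∫ p in (0:ℝ)..R, (∫ s in Set.Ioi (0:ℝ), φ s * J0 (p * s) * s) * J0 (p * r) * p =
        ∫ s in Set.Ioi (0:ℝ), φ s * hankelKernel r R s := by
  have hUc := continuous_besselU
  have hJc := continuous_J0
  set G : ℝ → ℝ → ℝ := fun p s => √p * (φ s * √s) * (besselU (p * s) * J0 (p * r)) with hG
  have hsq : IntegrableOn (fun p : ℝ => √p) (Set.Ioc 0 R) :=
    (Real.continuous_sqrt.integrableOn_Icc (a := 0) (b := R)).mono_set Set.Ioc_subset_Icc_self
  have hGi : Integrable (Function.uncurry G)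
      ((volume.restrict (Set.Ioc 0 R)).prod (volume.restrict (Set.Ioi 0))) := by
    refine (hsq.mul_prod hint).mul_bdd (c := 2)
      (g := fun z : ℝ × ℝ => besselU (z.1 * z.2) * J0 (z.1 * r))
      (by fun_prop : Continuous _).aestronglyMeasurable (ae_of_all _ fun z => ?_)
    exact abs_mul_le_of_abs_le_one (abs_besselU_le _) (abs_J0_le_one _)
  have hGe : ∀ p, 0 < p → ∀ s, 0 < s → G p s = φ s * J0 (p * s) * s * J0 (p * r) * p := by
    intro p hp s hs
    have h1 := Real.mul_self_sqrt hs.le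
    have h2 := Real.mul_self_sqrt hp.le
    simp only [hG, besselU]
    rw [Real.sqrt_mul hp.le]
    linear_combination φ s * J0 (p * s) * J0 (p * r) * (√p * √p) * h1 +
      φ s * J0 (p * s) * J0 (p * r) * s * h2
  have e1 : ∀ s ∈ Set.Ioi (0:ℝ), ∫ p in Set.Ioc 0 R, G p s = φ s * hankelKernel r R s := by
    intro s hs
    rw [hankelKernel, ← mul_assoc, intervalIntegral.integral_of_le hR, ← integral_const_mul]
    refine setIntegral_congr_fun measurableSet_Ioc fun p hp => ?_
    simp only [hGe p hp.1 s hs]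
    ring
  have e2 : ∀ p ∈ Set.Ioc 0 R, (∫ s in Set.Ioi (0:ℝ), φ s * J0 (p * s) * s) * J0 (p * r) * p =
      ∫ s in Set.Ioi 0, G p s := by
    intro p hp
    rw [← integral_mul_const, ← integral_mul_const]
    exact setIntegral_congr_fun measurableSet_Ioi fun s hs => (hGe p hp.1 s hs).symm
  refine ⟨(integrableOn_congr_fun e1 measurableSet_Ioi).1 hGi.integral_prod_right, ?_⟩
  rw [intervalIntegral.integral_of_le hR, setIntegral_congr_fun measurableSet_Ioc e2,
    integral_integral_swap hGi, setIntegral_congr_fun measurableSet_Ioi e1]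

lemma exists_abs_hankel_sub_mul_le {φ : ℝ → ℝ} {r : ℝ} (hr : 0 < r)
    (hφ : ContinuousOn φ (Set.Ioi 0))
    (hv : ∀ a b : ℝ, 0 < a → a ≤ b → BoundedVariationOn φ (Set.Icc a b))
    (hint : IntegrableOn (fun s => |φ s| * √s) (Set.Ioi 0)) {ε : ℝ} (hε : 0 < ε) :
    ∃ δ₀ > 0, ∀ δ, 0 < δ → δ ≤ δ₀ → ∀ᶠ R in atTop,
      |(∫ p in (0:ℝ)..R, (∫ s in Set.Ioi (0:ℝ), φ s * J0 (p * s) * s) * J0 (p * r) * p) -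
        φ r * ∫ s in (r - δ)..(r + δ), hankelKernel r R s| ≤ ε := by
  have hsub : Set.Icc (r - r / 2) (r + r / 2) ⊆ Set.Ioi 0 := fun s hs => by
    have := hs.1
    rw [Set.mem_Ioi]
    linarith
  obtain ⟨δ₁, hδ₁, h1⟩ :=
    (hv (r - r / 2) (r + r / 2) (by linarith)
      (by linarith)).exists_abs_integral_sub_mul_hankelKernel_le hr (hφ.mono hsub) (half_pos hε)
  refine ⟨min δ₁ (r / 2), by positivity, fun δ hδ hδ' => ?_⟩
  have hδr := hδ'.trans (min_le_right _ _)
  have hδ1 := hδ'.trans (min_le_left _ _)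
  have hI := integrableOn_mul_sqrt hφ hint
  have hfar := (tendsto_setIntegral_mul_hankelKernel hr hδ hI).abs.eventually
    (gt_mem_nhds (by rw [abs_zero]; exact half_pos hε))
  filter_upwards [hfar, eventually_ge_atTop (2 / r)] with R hRfar hR
  have hR0 : 0 ≤ R := le_trans (by positivity) hR
  obtain ⟨hKi, hT⟩ := integrableOn_and_integral_hankel_eq (r := r) hR0 hI
  have hnear := h1 δ hδ hδ1 R hR
  have hIoc : Set.Ioc (r - δ) (r + δ) ⊆ Set.Ioi 0 := fun s hs => by
    have := hs.1
    rw [Set.mem_Ioi]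
    linarith
  have hkc := continuous_hankelKernel r R
  have hφK : IntervalIntegrable (fun s => φ s * hankelKernel r R s) volume (r - δ) (r + δ) :=
    (intervalIntegrable_iff_integrableOn_Ioc_of_le (by linarith)).2 (hKi.mono_set hIoc)
  have hsplit := setIntegral_sdiff measurableSet_Ioc hKi hIoc
  rw [← intervalIntegral.integral_of_le (by linarith)] at hsplit
  simp_rw [sub_mul] at hnear
  rw [intervalIntegral.integral_sub hφK ((hkc.intervalIntegrable _ _).const_mul _),
    intervalIntegral.integral_const_mul] at hnear
  rw [hT]
  rw [abs_le] at hnear ⊢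
  have := abs_lt.1 hRfar
  constructor <;> linarith

lemma integrableOn_abs_exp_mul_sqrt :
    IntegrableOn (fun s => |Real.exp (-s ^ 2 / 2)| * √s) (Set.Ioi 0) := by
  refine (integrableOn_rpow_mul_exp_neg_sq_div_two (k := 1 / 2) (by norm_num)).congr_fun
    (fun s _ => ?_) measurableSet_Ioi
  simp only [abs_of_pos (Real.exp_pos _), Real.sqrt_eq_rpow, mul_comm]

lemma boundedVariationOn_exp_neg_sq_div_two {a b : ℝ} (ha : 0 < a) (hab : a ≤ b) :
    BoundedVariationOn (fun s => Real.exp (-s ^ 2 / 2)) (Set.Icc a b) := by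
  have hm : MonotoneOn (fun s => -Real.exp (-s ^ 2 / 2)) (Set.Icc a b) := by
    intro x hx y hy hxy
    simp only [neg_le_neg_iff, Real.exp_le_exp]
    have := hx.1
    nlinarith
  have h := hm.locallyBoundedVariationOn a b ⟨le_rfl, hab⟩ ⟨hab, le_rfl⟩
  rw [Set.inter_self] at h
  simpa [Function.comp_def] using
    LipschitzWith.comp_boundedVariationOn (f := fun x : ℝ => -x) (C := 1)
      (LipschitzWith.id.neg) h

theorem hankel_inversion_J0 (f : ℝ → ℝ)
    (hcont : ContinuousOn f (Set.Ioi 0))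
    (hbv : ∀ a b : ℝ, 0 < a → a ≤ b → BoundedVariationOn f (Set.Icc a b))
    (hint : IntegrableOn (fun r => |f r| * Real.sqrt r) (Set.Ioi 0)) :
    ∀ r > (0:ℝ),
      Tendsto
        (fun R => ∫ p in (0:ℝ)..R,
          (∫ s in Set.Ioi (0:ℝ), f s * J0 (p * s) * s) * J0 (p * r) * p)
        atTop (𝓝 (f r)) := by
  intro r hr
  refine Metric.tendsto_nhds.2 fun ε hε => ?_
  have hE : 0 < Real.exp (-r ^ 2 / 2) := Real.exp_pos _
  set η := ε * Real.exp (-r ^ 2 / 2) / (4 * (|f r| + 1)) with hη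
  have hη0 : 0 < η := by positivity
  obtain ⟨δ₁, hδ₁, h1⟩ := exists_abs_hankel_sub_mul_le hr hcont hbv hint
    (ε := ε / 4) (by linarith)
  obtain ⟨δ₂, hδ₂, h2⟩ := exists_abs_hankel_sub_mul_le (φ := fun s => Real.exp (-s ^ 2 / 2)) hr
    (by fun_prop) (fun a b => boundedVariationOn_exp_neg_sq_div_two)
    integrableOn_abs_exp_mul_sqrt hη0
  have hδ : 0 < min δ₁ δ₂ := lt_min hδ₁ hδ₂
  filter_upwards [h1 _ hδ (min_le_left _ _), h2 _ hδ (min_le_right _ _),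
    Metric.tendsto_nhds.1 (tendsto_hankel_inversion_exp r) η hη0] with R hf hg hg'
  rw [Real.dist_eq] at hg' ⊢
  set κ := ∫ s in (r - min δ₁ δ₂)..(r + min δ₁ δ₂), hankelKernel r R s
  have hκ : |Real.exp (-r ^ 2 / 2) * (κ - 1)| ≤ 2 * η := by
    have := abs_lt.1 hg'
    rw [abs_le] at hg ⊢
    constructor <;> linarith
  rw [abs_mul, abs_of_pos hE, mul_comm, ← le_div_iff₀ hE] at hκ
  have hfκ : |f r * (κ - 1)| ≤ ε / 2 := by
    rw [abs_mul]
    calc |f r| * |κ - 1| ≤ |f r| * (2 * η / Real.exp (-r ^ 2 / 2)) :=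
          mul_le_mul_of_nonneg_left hκ (abs_nonneg _)
      _ = ε / 2 * (|f r| / (|f r| + 1)) := by
        rw [hη]
        field_simp
        ring
      _ ≤ ε / 2 := by
        refine mul_le_of_le_one_right (by positivity) ?_
        rw [div_le_one (by positivity)]
        linarith
  rw [abs_le] at hf hfκ
  rw [abs_lt]
  constructor <;> linarith
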